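/- There exists P such that for every prime p ≥ P the following holds. Let T = φ(p-1) - 1. If 2^T - 1 is a (Mersenne) prime, then the 2-adic complexity of the sequence (s_n) attains its maximal value: C(s_n) = ⌊log_2(2^T - 1)⌋. -/

import Mathlib

/-- The primitive roots modulo `p` in increasing order: `g_1 < g_2 < … < g_{φ(p-1)}`
(0-indexed as a sorted list). -/
noncomputable def primRootsList (p : ℕ) : List ℕ :=
  ((Finset.Ico 1 p).filter fun g : ℕ => orderOf ((g : ZMod p)) = p - 1).sort (· ≤ ·)

/-- The binary sequence `s_n ≡ g_{n+1} + g_{n+2} (mod 2)` of period `T = φ(p-1) - 1`,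
extended `T`-periodically. -/
noncomputable def seqS (p n : ℕ) : ℕ :=
  ((primRootsList p).getD (n % (Nat.totient (p - 1) - 1)) 0 +
    (primRootsList p).getD (n % (Nat.totient (p - 1) - 1) + 1) 0) % 2

/-- `S(2) = Σ_{n=0}^{T-1} s_n 2^n ∈ ℤ≥0`, `T = φ(p-1) - 1`. -/
noncomputable def Stwo (p : ℕ) : ℕ :=
  ∑ n ∈ Finset.range (Nat.totient (p - 1) - 1), seqS p n * 2 ^ n

/-- The `2`-adic complexity `C(s_n) = ⌊log₂((2^T - 1)/gcd(2^T - 1, S(2)))⌋`. -/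
noncomputable def twoAdicComp (p : ℕ) : ℕ :=
  Nat.log 2 ((2 ^ (Nat.totient (p - 1) - 1) - 1) /
    Nat.gcd (2 ^ (Nat.totient (p - 1) - 1) - 1) (Stwo p))

lemma norm_mulChar_of_ne_zero {F : Type*} [Field F] [Fintype F] (χ : MulChar F ℂ) {a : F}
    (ha : a ≠ 0) : ‖χ a‖ = 1 := by
  have h : χ a ^ (Fintype.card F - 1) = 1 := by
    rw [← map_pow, FiniteField.pow_card_sub_one_eq_one a ha, map_one]
  have hc : 1 < Fintype.card F := Fintype.one_lt_card
  exact Complex.norm_eq_one_of_pow_eq_one h (by omega)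

lemma norm_jacobiSum_sub_le {F : Type*} [Field F] [Fintype F] [DecidableEq (MulChar F ℂ)]
    (hF : 4 ≤ Fintype.card F) (χ ψ : MulChar F ℂ) :
    ‖jacobiSum χ ψ - (if χ = 1 ∧ ψ = 1 then (Fintype.card F : ℂ) else 0)‖ ≤
      √(Fintype.card F : ℝ) := by
  have h2 : (2 : ℝ) ≤ √(Fintype.card F : ℝ) := by
    apply Real.le_sqrt_of_sq_le
    have : (4 : ℝ) ≤ Fintype.card F := by exact_mod_cast hF
    linarith
  by_cases hχ : χ = 1
  · by_cases hψ : ψ = 1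
    · subst hχ hψ
      simpa [jacobiSum_one_one] using h2
    · subst hχ
      simp [jacobiSum_one_nontrivial hψ, hψ]
      linarith
  · by_cases hψ : ψ = 1
    · subst hψ
      rw [jacobiSum_comm, jacobiSum_one_nontrivial hχ]
      simp [hχ]
      linarith
    · simp only [hχ, false_and, if_false, sub_zero]
      by_cases hm : χ * ψ = 1
      · rw [eq_inv_of_mul_eq_one_right hm, jacobiSum_nontrivial_inv hχ, norm_neg,
          norm_mulChar_of_ne_zero χ (by simp)]
        linarith
      · have key := jacobiSum_mul_jacobiSum_inv (F := F) (F' := ℂ) (by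
          rw [ringChar.eq_zero]
          exact (CharP.ringChar_ne_zero_of_finite F).symm) hχ hψ hm
        have hst : jacobiSum χ⁻¹ ψ⁻¹ = star (jacobiSum χ ψ) := by
          simp only [jacobiSum, star_sum, star_mul', MulChar.star_apply']
        rw [hst] at key
        have := congrArg norm key
        rw [norm_mul, norm_star] at this
        apply Real.le_sqrt_of_sq_le
        rw [sq, this]
        simp

lemma norm_sum_mulChar_mul_shift_le {F : Type*} [Field F] [Fintype F]
    [DecidableEq (MulChar F ℂ)] (hF : 4 ≤ Fintype.card F) (χ ψ : MulChar F ℂ) {h k : F}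
    (hk : h ≠ k) :
    ‖∑ a, χ (a + h) * ψ (a + k) - (if χ = 1 ∧ ψ = 1 then (Fintype.card F : ℂ) else 0)‖ ≤
      √(Fintype.card F : ℝ) := by
  have h1 : h - k ≠ 0 := sub_ne_zero.2 hk
  have h2 : k - h ≠ 0 := sub_ne_zero.2 hk.symm
  have hsum : ∑ a, χ (a + h) * ψ (a + k) = χ (h - k) * ψ (k - h) * jacobiSum χ ψ := by
    rw [jacobiSum, Finset.mul_sum]
    symm
    refine Fintype.sum_equiv ((Equiv.mulLeft₀ (h - k) h1).trans (Equiv.subRight h)) _ _ fun y ↦ ?_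
    change _ = χ ((h - k) * y - h + h) * ψ ((h - k) * y - h + k)
    rw [show (h - k) * y - h + h = (h - k) * y by ring,
      show (h - k) * y - h + k = (k - h) * (1 - y) by ring, map_mul, map_mul]
    ring
  have hmain : (if χ = 1 ∧ ψ = 1 then (Fintype.card F : ℂ) else 0) =
      χ (h - k) * ψ (k - h) * (if χ = 1 ∧ ψ = 1 then (Fintype.card F : ℂ) else 0) := by
    split_ifs with hc
    · rw [hc.1, hc.2, MulChar.one_apply (isUnit_iff_ne_zero.2 h1),
        MulChar.one_apply (isUnit_iff_ne_zero.2 h2)]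
      simp
    · simp
  rw [hsum, hmain, ← mul_sub, norm_mul, norm_mul, norm_mulChar_of_ne_zero χ h1,
    norm_mulChar_of_ne_zero ψ h2, one_mul, one_mul]
  exact norm_jacobiSum_sub_le hF χ ψ

lemma exists_mulChar_pow_apply_eq_one_iff (F : Type*) [Field F] [Fintype F] :
    ∃ χ : MulChar F ℂ, orderOf χ = Fintype.card F - 1 ∧
      ∀ x : F, x ≠ 0 → (χ x = 1 ↔ x = 1) := by
  classical
  obtain ⟨χ, hχ⟩ := MulChar.exists_mulChar_orderOf_eq_card_units F (R := ℂ)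
    (Complex.isPrimitiveRoot_exp _ (Fintype.card_ne_zero))
  refine ⟨χ, by rw [hχ, Fintype.card_units], fun x hx ↦ ⟨fun h ↦ ?_, fun h ↦ by simp [h]⟩⟩
  obtain ⟨g, hg⟩ := IsCyclic.exists_generator (α := Fˣ)
  obtain ⟨m, hm⟩ := (mem_powers_iff_mem_zpowers).2 (hg (Units.mk0 x hx))
  have hx' : x = (g : F) ^ m := by
    have := congrArg Units.val hm
    simpa using this.symm
  have h1 : χ ^ m = 1 := by
    rw [MulChar.eq_iff hg, MulChar.pow_apply_coe, MulChar.one_apply_coe, ← map_pow, ← hx', h]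
  have hd : Fintype.card Fˣ ∣ m := hχ ▸ orderOf_dvd_of_pow_eq_one h1
  have : g ^ m = 1 := orderOf_dvd_iff_pow_eq_one.1 (orderOf_dvd_card.trans hd)
  have h3 := congrArg Units.val (this.symm.trans hm)
  simpa using h3.symm

open ArithmeticFunction in
lemma sum_divisors_moebius_div (n : ℕ) (hn : 0 < n) :
    ∑ d ∈ n.divisors, (moebius d : ℂ) / d = n.totient / n := by
  have h := (sum_eq_iff_sum_mul_moebius_eq (R := ℂ) (f := fun n ↦ (n.totient : ℂ))
    (g := fun n ↦ (n : ℂ))).1 (fun m _ ↦ by exact_mod_cast m.sum_totient) n hn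
  have hn' : (n : ℂ) ≠ 0 := by exact_mod_cast hn.ne'
  rw [← h, Nat.sum_divisorsAntidiagonal (fun a b ↦ (moebius a : ℂ) * (b : ℂ)), Finset.sum_div]
  refine Finset.sum_congr rfl fun d hd ↦ ?_
  have hd' : (d : ℂ) ≠ 0 := by exact_mod_cast (Nat.pos_of_mem_divisors hd).ne'
  rw [Nat.cast_div (Nat.dvd_of_mem_divisors hd) hd']
  field_simp

open ArithmeticFunction in
lemma sum_divisors_moebius_ite_dvd_div {m n : ℕ} (hn : 0 < n) (hm : m ∣ n) :
    ∑ d ∈ n.divisors, (if m ∣ n / d then (moebius d : ℂ) else 0) = if m = n then 1 else 0 := by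
  obtain ⟨t, rfl⟩ := hm
  have hm0 : 0 < m := Nat.pos_of_mul_pos_right hn
  have ht0 : 0 < t := Nat.pos_of_mul_pos_left hn
  rw [← Finset.sum_filter]
  have hset : {d ∈ (m * t).divisors | m ∣ m * t / d} = t.divisors := by
    ext d
    simp only [Finset.mem_filter, Nat.mem_divisors]
    constructor
    · rintro ⟨⟨hd, -⟩, e, he⟩
      refine ⟨⟨e, ?_⟩, ht0.ne'⟩
      have := Nat.mul_div_cancel' hd
      rw [he] at this
      apply Nat.eq_of_mul_eq_mul_left hm0
      rw [← this]
      ring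
    · rintro ⟨hd, -⟩
      exact ⟨⟨hd.mul_left m, hn.ne'⟩, by rw [Nat.mul_div_assoc _ hd]; exact dvd_mul_right _ _⟩
  rw [hset]
  have h := congrArg (fun F : ArithmeticFunction ℤ ↦ F t) moebius_mul_coe_zeta
  rw [coe_mul_zeta_apply, one_apply] at h
  have h' := congrArg (Int.cast : ℤ → ℂ) h
  push_cast at h'
  rw [h']
  have : m = m * t ↔ t = 1 := by
    constructor
    · intro h
      exact Nat.eq_of_mul_eq_mul_left hm0 (by omega)
    · rintro rfl
      simp
  simp only [this]

lemma sum_range_pow_eq_ite {r : ℂ} {d : ℕ} (hr : r ^ d = 1) :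
    ∑ j ∈ Finset.range d, r ^ j = if r = 1 then (d : ℂ) else 0 := by
  split_ifs with h
  · simp [h]
  · have := geom_sum_mul r d
    rw [hr, sub_self] at this
    exact (mul_eq_zero.1 this).resolve_right (sub_ne_zero.2 h)

open ArithmeticFunction in
lemma ite_orderOf_eq_sum_mulChar {F : Type*} [Field F] [Fintype F] {χ : MulChar F ℂ}
    (hχ : ∀ x : F, x ≠ 0 → (χ x = 1 ↔ x = 1)) (x : F) :
    (if orderOf x = Fintype.card F - 1 then (1 : ℂ) else 0) =
      ∑ i ∈ (Fintype.card F - 1).divisors.sigma fun d ↦ Finset.range d,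
        (moebius i.1 / i.1 : ℂ) * (χ ^ ((Fintype.card F - 1) / i.1 * i.2)) x := by
  have hc : 1 < Fintype.card F := Fintype.one_lt_card
  set n := Fintype.card F - 1 with hn
  have hn0 : 0 < n := by omega
  rcases eq_or_ne x 0 with rfl | hx
  · rw [orderOf_zero, if_neg hn0.ne]
    exact (Finset.sum_eq_zero fun i _ ↦ by rw [MulChar.map_zero, mul_zero]).symm
  have hxn : x ^ n = 1 := FiniteField.pow_card_sub_one_eq_one x hx
  rw [Finset.sum_sigma, ← sum_divisors_moebius_ite_dvd_div hn0 (orderOf_dvd_of_pow_eq_one hxn)]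
  refine Finset.sum_congr rfl fun d hd ↦ ?_
  have hdn := Nat.dvd_of_mem_divisors hd
  have hd0 : (d : ℂ) ≠ 0 := by exact_mod_cast (Nat.pos_of_mem_divisors hd).ne'
  dsimp only
  rw [← Finset.mul_sum]
  have hpow : ∀ j, (χ ^ (n / d * j)) x = (χ (x ^ (n / d))) ^ j := by
    intro j
    rw [← map_pow, ← pow_mul]
    have := MulChar.pow_apply_coe χ (n / d * j) (Units.mk0 x hx)
    simpa using this
  have hr : χ (x ^ (n / d)) ^ d = 1 := by
    rw [← map_pow, ← pow_mul, Nat.div_mul_cancel hdn, hxn, map_one]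
  simp only [hpow]
  have hiff : orderOf x ∣ n / d ↔ χ (x ^ (n / d)) = 1 := by
    rw [hχ _ (pow_ne_zero _ hx), orderOf_dvd_iff_pow_eq_one]
  simp only [sum_range_pow_eq_ite hr, hiff]
  split_ifs
  · field_simp
  · simp

lemma norm_correlation_sub_le {F ι : Type*} [Field F] [Fintype F]
    [DecidableEq (MulChar F ℂ)] (hF : 4 ≤ Fintype.card F) (s : Finset ι) (c : ι → ℂ)
    (χ : ι → MulChar F ℂ) {f : F → ℂ} (hf : ∀ x, f x = ∑ i ∈ s, c i * χ i x) {h k : F}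
    (hk : h ≠ k) :
    ‖∑ a, f (a + h) * f (a + k) -
        (∑ i ∈ s, if χ i = 1 then c i else 0) ^ 2 * (Fintype.card F : ℂ)‖ ≤
      (∑ i ∈ s, ‖c i‖) ^ 2 * √(Fintype.card F : ℝ) := by
  have h1 : ∑ a, f (a + h) * f (a + k) =
      ∑ i ∈ s, ∑ j ∈ s, c i * c j * ∑ a, χ i (a + h) * χ j (a + k) := by
    simp_rw [hf, Finset.sum_mul_sum, Finset.mul_sum]
    rw [Finset.sum_comm]
    refine Finset.sum_congr rfl fun i _ ↦ ?_
    rw [Finset.sum_comm]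
    refine Finset.sum_congr rfl fun j _ ↦ Finset.sum_congr rfl fun a _ ↦ ?_
    ring
  have h2 : (∑ i ∈ s, if χ i = 1 then c i else 0) ^ 2 * (Fintype.card F : ℂ) =
      ∑ i ∈ s, ∑ j ∈ s,
        c i * c j * (if χ i = 1 ∧ χ j = 1 then (Fintype.card F : ℂ) else 0) := by
    rw [sq, Finset.sum_mul_sum, Finset.sum_mul]
    refine Finset.sum_congr rfl fun i _ ↦ ?_
    rw [Finset.sum_mul]
    refine Finset.sum_congr rfl fun j _ ↦ ?_
    by_cases hi : χ i = 1 <;> by_cases hj : χ j = 1 <;> simp [hi, hj]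
  rw [h1, h2, ← Finset.sum_sub_distrib, sq, Finset.sum_mul_sum, Finset.sum_mul]
  refine (norm_sum_le _ _).trans (Finset.sum_le_sum fun i _ ↦ ?_)
  rw [← Finset.sum_sub_distrib, Finset.sum_mul]
  refine (norm_sum_le _ _).trans (Finset.sum_le_sum fun j _ ↦ ?_)
  rw [← mul_sub, norm_mul, norm_mul]
  exact mul_le_mul_of_nonneg_left (norm_sum_mulChar_mul_shift_le hF _ _ hk) (by positivity)

/-- The indicator function of the generators of the multiplicative group. -/
noncomputable def genIndicator (F : Type*) [Field F] [Fintype F] (x : F) : ℝ :=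
  if orderOf x = Fintype.card F - 1 then 1 else 0

lemma abs_genIndicator_correlation_sub_le {F : Type*} [Field F] [Fintype F]
    (hF : 4 ≤ Fintype.card F) {h k : F} (hk : h ≠ k) :
    |∑ a, genIndicator F (a + h) * genIndicator F (a + k) -
        ((Fintype.card F - 1).totient / ((Fintype.card F - 1 : ℕ) : ℝ)) ^ 2 * Fintype.card F| ≤
      ((Fintype.card F - 1).divisors.card : ℝ) ^ 2 * √(Fintype.card F : ℝ) := by
  classical
  obtain ⟨χ, hord, hχ⟩ := exists_mulChar_pow_apply_eq_one_iff F
  have hn0 : 0 < Fintype.card F - 1 := by omega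
  have key := norm_correlation_sub_le hF
    ((Fintype.card F - 1).divisors.sigma fun d ↦ Finset.range d)
    (fun i ↦ (ArithmeticFunction.moebius i.1 / i.1 : ℂ))
    (fun i ↦ χ ^ ((Fintype.card F - 1) / i.1 * i.2))
    (ite_orderOf_eq_sum_mulChar hχ) hk
  set n := Fintype.card F - 1 with hn
  have hmain : (∑ i ∈ n.divisors.sigma fun d ↦ Finset.range d,
      if χ ^ (n / i.1 * i.2) = 1 then (ArithmeticFunction.moebius i.1 / i.1 : ℂ) else 0) =
      n.totient / n := by
    rw [Finset.sum_sigma, ← sum_divisors_moebius_div n hn0]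
    refine Finset.sum_congr rfl fun d hd ↦ ?_
    have hdn := Nat.dvd_of_mem_divisors hd
    have hd0 := Nat.pos_of_mem_divisors hd
    have hnd : 0 < n / d := Nat.div_pos (Nat.le_of_dvd hn0 hdn) hd0
    rw [Finset.sum_eq_single_of_mem 0 (Finset.mem_range.2 hd0)]
    · simp
    · intro j hj hj0
      refine if_neg fun h1 ↦ ?_
      have h2 := orderOf_dvd_of_pow_eq_one h1
      rw [hord] at h2
      have h3 := Nat.le_of_dvd (Nat.mul_pos hnd (Nat.pos_of_ne_zero hj0)) h2
      have h4 : n / d * j < n / d * d := Nat.mul_lt_mul_of_pos_left (Finset.mem_range.1 hj) hnd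
      rw [Nat.div_mul_cancel hdn] at h4
      omega
  have hnorm : (∑ i ∈ n.divisors.sigma fun d ↦ Finset.range d,
      ‖(ArithmeticFunction.moebius i.1 / i.1 : ℂ)‖) ≤ n.divisors.card := by
    rw [Finset.sum_sigma, Finset.card_eq_sum_ones, Nat.cast_sum]
    refine Finset.sum_le_sum fun d hd ↦ ?_
    have hd0 : (0 : ℝ) < d := by exact_mod_cast Nat.pos_of_mem_divisors hd
    have hmu : |(ArithmeticFunction.moebius d : ℝ)| ≤ 1 := by
      exact_mod_cast ArithmeticFunction.abs_moebius_le_one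
    simp only [Finset.sum_const, Finset.card_range, nsmul_eq_mul, norm_div, Complex.norm_intCast,
      Complex.norm_natCast, Nat.cast_one]
    rw [mul_div_cancel₀ _ hd0.ne']
    exact hmu
  rw [hmain] at key
  have hcast : ((∑ a, genIndicator F (a + h) * genIndicator F (a + k) -
        (n.totient / (n : ℝ)) ^ 2 * Fintype.card F : ℝ) : ℂ) =
      ∑ a : F, (if orderOf (a + h) = n then (1 : ℂ) else 0) *
        (if orderOf (a + k) = n then (1 : ℂ) else 0) -
        (n.totient / (n : ℂ)) ^ 2 * (Fintype.card F : ℂ) := by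
    simp only [genIndicator, ← hn]
    push_cast [apply_ite (Complex.ofReal)]
    rfl
  rw [← Real.norm_eq_abs, ← Complex.norm_real, hcast]
  refine key.trans ?_
  gcongr

lemma Nat.le_totient_mul_card_divisors (n : ℕ) : n ≤ n.totient * n.divisors.card := by
  rcases n.eq_zero_or_pos with rfl | hn
  · simp
  calc n = ∑ d ∈ n.divisors, d.totient := n.sum_totient.symm
    _ ≤ ∑ _d ∈ n.divisors, n.totient := Finset.sum_le_sum fun d hd ↦
        Nat.le_of_dvd (Nat.totient_pos.2 hn) (Nat.totient_dvd_of_dvd (Nat.dvd_of_mem_divisors hd))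
    _ = n.totient * n.divisors.card := by rw [Finset.sum_const, smul_eq_mul, mul_comm]

lemma Nat.two_mul_totient_le_of_even {n : ℕ} (hn : Even n) : 2 * n.totient ≤ n := by
  rcases n.eq_zero_or_pos with rfl | hpos
  · simp
  obtain ⟨m, rfl⟩ := hn
  have hm : 0 < m := by omega
  have hsub : {a ∈ Finset.range (m + m) | (m + m).Coprime a} ⊆
      (Finset.range m).image fun i ↦ 2 * i + 1 := by
    intro a ha
    rw [Finset.mem_filter, Finset.mem_range] at ha
    have hodd : ¬ 2 ∣ a := fun h2 ↦
      Nat.not_coprime_of_dvd_of_dvd one_lt_two (by omega : 2 ∣ m + m) h2 ha.2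
    exact Finset.mem_image.2 ⟨a / 2, Finset.mem_range.2 (by omega), by omega⟩
  have h := (Finset.card_le_card hsub).trans Finset.card_image_le
  rw [Finset.card_range] at h
  rw [Nat.totient_eq_card_coprime]
  omega

lemma Nat.succ_pow_nine_le (a : ℕ) : (a + 1) ^ 9 ≤ (Nat.factorial 9 * 2 ^ 9) * 2 ^ a := by
  calc (a + 1) ^ 9 ≤ (a + 1).ascFactorial 9 := Nat.pow_succ_le_ascFactorial _ _
    _ = Nat.factorial 9 * (a + 9).choose 9 := by
        rw [Nat.ascFactorial_eq_factorial_mul_choose]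
    _ ≤ Nat.factorial 9 * 2 ^ (a + 9) := Nat.mul_le_mul_left _ (Nat.choose_le_two_pow _ _)
    _ = _ := by rw [pow_add]; ring

lemma exists_card_divisors_pow_nine_le :
    ∃ C : ℕ, ∀ n : ℕ, n ≠ 0 → n.divisors.card ^ 9 ≤ C * n := by
  obtain ⟨B, hB1, hB⟩ : ∃ B : ℕ, 1 ≤ B ∧ ∀ a : ℕ, (a + 1) ^ 9 ≤ B * 2 ^ a :=
    ⟨_, Nat.mul_pos (Nat.factorial_pos 9) (by positivity), Nat.succ_pow_nine_le⟩
  refine ⟨B ^ (Finset.range 512).card, fun n hn ↦ ?_⟩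
  have hlocal : ∀ q ∈ n.primeFactors, (n.factorization q + 1) ^ 9 ≤
      (if q < 512 then B else 1) * q ^ n.factorization q := by
    intro q hq
    have hq2 := (Nat.prime_of_mem_primeFactors hq).two_le
    split_ifs with h
    · exact (hB _).trans (Nat.mul_le_mul_left _ (Nat.pow_le_pow_left hq2 _))
    · rw [one_mul]
      calc (n.factorization q + 1) ^ 9 ≤ (2 ^ n.factorization q) ^ 9 :=
            Nat.pow_le_pow_left Nat.lt_two_pow_self _
        _ = 512 ^ n.factorization q := by rw [← pow_mul, mul_comm, pow_mul]; norm_num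
        _ ≤ q ^ n.factorization q := Nat.pow_le_pow_left (by omega) _
  have hB512 : ∏ q ∈ n.primeFactors, (if q < 512 then B else 1) ≤ B ^ (Finset.range 512).card := by
    rw [← Finset.prod_filter, Finset.prod_const]
    refine Nat.pow_le_pow_right hB1 ?_
    exact Finset.card_le_card fun q hq ↦ Finset.mem_range.2 (Finset.mem_filter.1 hq).2
  rw [Nat.card_divisors hn, ← Finset.prod_pow]
  refine (Finset.prod_le_prod' hlocal).trans ?_
  rw [Finset.prod_mul_distrib]
  refine Nat.mul_le_mul hB512 (le_of_eq ?_)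
  exact Nat.prod_factorization_pow_eq_self hn

lemma exists_forall_mul_card_divisors_pow_eight_lt (M : ℕ) :
    ∃ P : ℕ, ∀ n : ℕ, P ≤ n → M * n.divisors.card ^ 8 < n := by
  obtain ⟨C, hC⟩ := exists_card_divisors_pow_nine_le
  refine ⟨M ^ 9 * C ^ 8 + 1, fun n hn ↦ ?_⟩
  have hn0 : 0 < n := by omega
  by_contra! h
  have h1 : n ^ 8 * n ≤ n ^ 8 * (M ^ 9 * C ^ 8) := by
    calc n ^ 8 * n = n ^ 9 := by ring
      _ ≤ (M * n.divisors.card ^ 8) ^ 9 := Nat.pow_le_pow_left h 9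
      _ = M ^ 9 * (n.divisors.card ^ 9) ^ 8 := by ring
      _ ≤ M ^ 9 * (C * n) ^ 8 :=
          Nat.mul_le_mul_left _ (Nat.pow_le_pow_left (hC n hn0.ne') 8)
      _ = n ^ 8 * (M ^ 9 * C ^ 8) := by ring
  have := Nat.le_of_mul_le_mul_left h1 (by positivity)
  omega

lemma card_filter_orderOf_eq_totient (F : Type*) [Field F] [Fintype F] [DecidableEq F] :
    (Finset.univ.filter fun x : F ↦ orderOf x = Fintype.card F - 1).card =
      (Fintype.card F - 1).totient := by
  have hc : 1 < Fintype.card F := Fintype.one_lt_card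
  have h := IsCyclic.card_orderOf_eq_totient (α := Fˣ) (d := Fintype.card F - 1)
    (by rw [Fintype.card_units])
  rw [← h]
  symm
  refine Finset.card_bij (fun u _ ↦ (u : F)) ?_ ?_ ?_
  · intro u hu
    simpa [orderOf_units] using hu
  · intro u _ v _ huv
    exact Units.ext huv
  · intro x hx
    rw [Finset.mem_filter] at hx
    have hx0 : x ≠ 0 := by
      rintro rfl
      rw [orderOf_zero] at hx
      omega
    refine ⟨Units.mk0 x hx0, ?_, rfl⟩
    rw [Finset.mem_filter, ← orderOf_units]
    exact ⟨Finset.mem_univ _, hx.2⟩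

lemma sum_genIndicator_mul_self (F : Type*) [Field F] [Fintype F] (h : F) :
    ∑ a, genIndicator F (a + h) * genIndicator F (a + h) = (Fintype.card F - 1).totient := by
  classical
  rw [← card_filter_orderOf_eq_totient F, Finset.card_filter, Nat.cast_sum]
  refine Fintype.sum_equiv (Equiv.addRight h) _ _ fun a ↦ ?_
  rw [Equiv.coe_addRight]
  unfold genIndicator
  split_ifs <;> simp

lemma le_sum_sq_alternating_window {F : Type*} [Field F] [Fintype F]
    (hF : 4 ≤ Fintype.card F) (L : ℕ) (u : ℕ → F) (hu : Set.InjOn u (Set.Iio L)) (θ K : ℝ)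
    (hθ : θ = (Fintype.card F - 1).totient / ((Fintype.card F - 1 : ℕ) : ℝ))
    (hK : K = (Fintype.card F - 1).divisors.card) :
    L * ((Fintype.card F - 1).totient - θ ^ 2 * Fintype.card F) -
        L ^ 2 * (K ^ 2 * √(Fintype.card F : ℝ)) ≤
      ∑ a, (∑ j ∈ Finset.range L, (-1 : ℝ) ^ j * genIndicator F (a + u j)) ^ 2 := by
  classical
  set R : ℕ → ℕ → ℝ := fun j k ↦ ∑ a, genIndicator F (a + u j) * genIndicator F (a + u k)
    with hR
  set E : ℝ := K ^ 2 * √(Fintype.card F : ℝ) with hE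
  set m : ℝ := θ ^ 2 * Fintype.card F with hm
  have hE0 : 0 ≤ E := by positivity
  have hexp : ∑ a, (∑ j ∈ Finset.range L, (-1 : ℝ) ^ j * genIndicator F (a + u j)) ^ 2 =
      ∑ j ∈ Finset.range L, ∑ k ∈ Finset.range L, (-1 : ℝ) ^ j * (-1) ^ k * R j k := by
    simp_rw [sq, Finset.sum_mul_sum, hR, Finset.mul_sum]
    rw [Finset.sum_comm]
    refine Finset.sum_congr rfl fun i _ ↦ ?_
    rw [Finset.sum_comm]
    refine Finset.sum_congr rfl fun j _ ↦ Finset.sum_congr rfl fun a _ ↦ ?_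
    ring
  have hterm : ∀ j ∈ Finset.range L, ∀ k ∈ Finset.range L,
      (-1 : ℝ) ^ j * (-1) ^ k * m +
        (if j = k then ((Fintype.card F - 1).totient - m : ℝ) else 0) - E ≤
        (-1 : ℝ) ^ j * (-1) ^ k * R j k := by
    intro j hj k hk
    split_ifs with hjk
    · subst hjk
      have h1 : (-1 : ℝ) ^ j * (-1) ^ j = 1 := by rw [← mul_pow]; simp
      have h2 : R j j = (Fintype.card F - 1).totient := sum_genIndicator_mul_self F (u j)
      rw [h1, h2]
      linarith
    · have hne : u j ≠ u k := fun h ↦ hjk (hu (Finset.mem_range.1 hj) (Finset.mem_range.1 hk) h)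
      have hb : |R j k - m| ≤ E := by
        rw [hm, hE, hθ, hK]
        exact abs_genIndicator_correlation_sub_le hF hne
      have h1 : |(-1 : ℝ) ^ j * (-1) ^ k * (R j k - m)| ≤ E := by
        rw [abs_mul, abs_mul, abs_pow, abs_pow]
        simpa using hb
      have h2 := (abs_le.1 h1).1
      rw [mul_sub] at h2
      linarith
  have hsq : ∑ j ∈ Finset.range L, ∑ k ∈ Finset.range L, (-1 : ℝ) ^ j * (-1) ^ k * m =
      (∑ j ∈ Finset.range L, (-1 : ℝ) ^ j) ^ 2 * m := by
    rw [sq, Finset.sum_mul_sum, Finset.sum_mul]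
    simp_rw [Finset.sum_mul]
  have hdiag : ∑ j ∈ Finset.range L, ∑ k ∈ Finset.range L,
      (if j = k then ((Fintype.card F - 1).totient - m : ℝ) else 0) =
      L * ((Fintype.card F - 1).totient - m) := by
    rw [Finset.sum_congr rfl fun j hj ↦ by rw [Finset.sum_ite_eq, if_pos hj]]
    rw [Finset.sum_const, Finset.card_range, nsmul_eq_mul]
  have hsum := Finset.sum_le_sum fun j hj ↦ Finset.sum_le_sum (hterm j hj)
  simp only [Finset.sum_sub_distrib, Finset.sum_add_distrib] at hsum
  rw [hsq, hdiag] at hsum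
  rw [hexp]
  refine le_trans ?_ hsum
  have hm0 : 0 ≤ (∑ j ∈ Finset.range L, (-1 : ℝ) ^ j) ^ 2 * m := by positivity
  simp only [Finset.sum_const, Finset.card_range, nsmul_eq_mul]
  linarith

lemma card_primitive_roots_Ico {p : ℕ} (hp : p.Prime) :
    ((Finset.Ico 1 p).filter fun g : ℕ => orderOf ((g : ZMod p)) = p - 1).card =
      (p - 1).totient := by
  have : Fact p.Prime := ⟨hp⟩
  have h := card_filter_orderOf_eq_totient (ZMod p)
  rw [ZMod.card] at h
  rw [← h]
  refine Finset.card_bij (fun g _ ↦ (g : ZMod p)) ?_ ?_ ?_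
  · intro g hg
    simpa using (Finset.mem_filter.1 hg).2
  · intro a ha b hb hab
    simp only [Finset.mem_filter, Finset.mem_Ico] at ha hb
    have := congrArg ZMod.val hab
    rwa [ZMod.val_natCast_of_lt ha.1.2, ZMod.val_natCast_of_lt hb.1.2] at this
  · intro x hx
    rw [Finset.mem_filter] at hx
    refine ⟨x.val, ?_, ZMod.natCast_zmod_val x⟩
    rw [Finset.mem_filter, Finset.mem_Ico, ZMod.natCast_zmod_val]
    refine ⟨⟨Nat.pos_of_ne_zero fun h0 ↦ ?_, ZMod.val_lt x⟩, hx.2⟩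
    rw [(ZMod.val_eq_zero x).1 h0, orderOf_zero] at hx
    have := hp.two_le
    omega

lemma mem_primRootsList {p g : ℕ} :
    g ∈ primRootsList p ↔ (1 ≤ g ∧ g < p) ∧ orderOf (g : ZMod p) = p - 1 := by
  simp [primRootsList]

lemma length_primRootsList {p : ℕ} (hp : p.Prime) :
    (primRootsList p).length = (p - 1).totient := by
  rw [primRootsList, Finset.length_sort, card_primitive_roots_Ico hp]

lemma genIndicator_natCast {p : ℕ} [Fact p.Prime] {g : ℕ} (hg : g < p) :
    genIndicator (ZMod p) (g : ZMod p) = if g ∈ primRootsList p then 1 else 0 := by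
  have h2 := (Fact.out : p.Prime).two_le
  simp only [genIndicator, ZMod.card, mem_primRootsList]
  refine if_congr ⟨fun h ↦ ⟨⟨Nat.pos_of_ne_zero fun h0 ↦ ?_, hg⟩, h⟩, fun h ↦ h.2⟩ rfl rfl
  rw [h0, Nat.cast_zero, orderOf_zero] at h
  omega

lemma gcd_sum_mul_two_pow_eq_one {T : ℕ} {s : ℕ → ℕ} (hs : ∀ n, s n ≤ 1)
    (hq : (2 ^ T - 1).Prime) (h0 : ¬ ∀ n < T, s n = 0) (h1 : ¬ ∀ n < T, s n = 1) :
    Nat.gcd (2 ^ T - 1) (∑ n ∈ Finset.range T, s n * 2 ^ n) = 1 := by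
  rw [← Nat.coprime_iff_gcd_eq_one, hq.coprime_iff_not_dvd]
  intro hdvd
  have hgeom : ∑ n ∈ Finset.range T, 2 ^ n = 2 ^ T - 1 := by
    simpa using Nat.geomSum_eq le_rfl T
  have hterm : ∀ n ∈ Finset.range T, s n * 2 ^ n ≤ 2 ^ n := fun n _ ↦
    (Nat.mul_le_mul_right _ (hs n)).trans_eq (one_mul _)
  rcases Nat.eq_zero_or_pos (∑ n ∈ Finset.range T, s n * 2 ^ n) with hz | hpos
  · refine h0 fun n hn ↦ ?_
    have := Finset.sum_eq_zero_iff.1 hz n (Finset.mem_range.2 hn)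
    simpa using this
  · have hle := Nat.le_of_dvd hpos hdvd
    rw [← hgeom] at hle
    have heq := le_antisymm (Finset.sum_le_sum hterm) hle
    rw [Finset.sum_eq_sum_iff_of_le hterm] at heq
    refine h1 fun n hn ↦ ?_
    have := heq n (Finset.mem_range.2 hn)
    simpa using this

lemma isChain_primRootsList_of_seqS_eq {p b : ℕ} (hp : p.Prime)
    (h : ∀ n < (p - 1).totient - 1, seqS p n = b) :
    (primRootsList p).IsChain fun x y ↦ (x + y) % 2 = b := by
  rw [List.isChain_iff_getElem]
  intro i hi
  have hlen := length_primRootsList hp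
  have hiT : i < (p - 1).totient - 1 := by omega
  have := h i hiT
  rw [seqS, Nat.mod_eq_of_lt hiT, List.getD_eq_getElem _ _ (by omega),
    List.getD_eq_getElem _ _ hi] at this
  exact this

lemma alternating_chain_partial_sum (x : ℕ) (t : List ℕ) : ∀ g : ℕ,
    (g :: t).Pairwise (· < ·) → (g :: t).IsChain (fun a b ↦ (a + b) % 2 = 1) →
    ((g :: t).map fun y ↦ if y < x then (-1 : ℝ) ^ y else 0).sum = 0 ∨
      ((g :: t).map fun y ↦ if y < x then (-1 : ℝ) ^ y else 0).sum = (-1) ^ g := by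
  induction t with
  | nil =>
    intro g _ _
    by_cases h : g < x <;> simp [h]
  | cons g' t ih =>
    intro g hsort hchain
    by_cases h : g < x
    · rw [List.isChain_cons_cons] at hchain
      have hpar : (-1 : ℝ) ^ g' = - (-1) ^ g := by
        have : (-1 : ℝ) ^ (g + g') = -1 := Odd.neg_one_pow (Nat.odd_iff.2 hchain.1)
        rw [pow_add] at this
        rcases neg_one_pow_eq_or ℝ g with h1 | h1 <;> rw [h1] at this ⊢ <;> linarith
      rw [List.map_cons, List.sum_cons, if_pos h]
      rcases ih g' (List.pairwise_cons.1 hsort).2 hchain.2 with h1 | h1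
      · right
        rw [h1, add_zero]
      · left
        rw [h1, hpar]
        ring
    · left
      refine List.sum_eq_zero fun y hy ↦ ?_
      obtain ⟨z, hz, rfl⟩ := List.mem_map.1 hy
      refine if_neg fun hzx ↦ ?_
      rcases List.mem_cons.1 hz with rfl | hz
      · exact h hzx
      · exact h (((List.pairwise_cons.1 hsort).1 z hz).trans hzx)

lemma abs_alternating_chain_partial_sum_sub_le {l : List ℕ} (hsort : l.Pairwise (· < ·))
    (hchain : l.IsChain fun a b ↦ (a + b) % 2 = 1) (x y : ℕ) :
    |(l.map fun z ↦ if z < x then (-1 : ℝ) ^ z else 0).sum -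
      (l.map fun z ↦ if z < y then (-1 : ℝ) ^ z else 0).sum| ≤ 1 := by
  cases l with
  | nil => simp
  | cons g t =>
    rcases alternating_chain_partial_sum x t g hsort hchain with h1 | h1 <;>
      rcases alternating_chain_partial_sum y t g hsort hchain with h2 | h2 <;>
      rw [h1, h2] <;> simp

lemma sum_range_eq_list_sum {l : List ℕ} (hl : l.Nodup) (x : ℕ) :
    ∑ m ∈ Finset.range x, (-1 : ℝ) ^ m * (if m ∈ l then 1 else 0) =
      (l.map fun z ↦ if z < x then (-1 : ℝ) ^ z else 0).sum := by
  rw [← List.sum_toFinset _ hl, ← Finset.sum_filter]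
  simp only [mul_ite, mul_one, mul_zero]
  rw [← Finset.sum_filter]
  refine Finset.sum_congr ?_ fun _ _ ↦ rfl
  ext m
  simp [and_comm]

lemma pairwise_primRootsList (p : ℕ) : (primRootsList p).Pairwise (· < ·) :=
  Finset.sortedLT_sort _ |>.pairwise

lemma sum_sq_alternating_window_le {p : ℕ} [Fact p.Prime] (hp : Odd p)
    (hchain : (primRootsList p).IsChain fun a b ↦ (a + b) % 2 = 1) {L : ℕ} (hL : L ≤ p) :
    ∑ a : ZMod p, (∑ j ∈ Finset.range L, (-1 : ℝ) ^ j * genIndicator (ZMod p) (a + j)) ^ 2 ≤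
      4 * p := by
  set E : ℕ → ℝ := fun x ↦ ∑ m ∈ Finset.range x, (-1 : ℝ) ^ m * genIndicator (ZMod p) m with hE
  have hE1 : ∀ x y, x ≤ p → y ≤ p → |E x - E y| ≤ 1 := by
    have hEl : ∀ x ≤ p, E x =
        ((primRootsList p).map fun z ↦ if z < x then (-1 : ℝ) ^ z else 0).sum := by
      intro x hx
      rw [← sum_range_eq_list_sum (pairwise_primRootsList p).nodup, hE]
      refine Finset.sum_congr rfl fun m hm ↦ ?_
      rw [genIndicator_natCast ((Finset.mem_range.1 hm).trans_le hx)]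
    intro x y hx hy
    rw [hEl x hx, hEl y hy]
    exact abs_alternating_chain_partial_sum_sub_le (pairwise_primRootsList p) hchain x y
  have hE0 : E 0 = 0 := by simp [hE]
  have hshift : ∀ y, E (p + y) = E p - E y := by
    intro y
    simp only [hE]
    rw [Finset.sum_range_add, sub_eq_add_neg, ← Finset.sum_neg_distrib]
    congr 1
    refine Finset.sum_congr rfl fun m _ ↦ ?_
    rw [pow_add, hp.neg_one_pow, Nat.cast_add, CharP.cast_eq_zero, zero_add]
    ring
  have hwin : ∀ a < p, |E (a + L) - E a| ≤ 2 := by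
    intro a ha
    rcases le_total (a + L) p with h | h
    · exact (hE1 _ _ h ha.le).trans one_le_two
    · obtain ⟨y, hy⟩ := Nat.exists_eq_add_of_le h
      have h1 := abs_le.1 (hE1 p a le_rfl ha.le)
      have h2 := abs_le.1 (hE1 y 0 (by omega) (Nat.zero_le _))
      rw [hy, hshift, abs_le]
      constructor <;> linarith [h1.1, h1.2, h2.1, h2.2]
  have hterm : ∀ a : ZMod p,
      (∑ j ∈ Finset.range L, (-1 : ℝ) ^ j * genIndicator (ZMod p) (a + j)) ^ 2 ≤ 4 := by
    intro a
    have h1 : E (a.val + L) - E a.val = (-1) ^ a.val *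
        ∑ j ∈ Finset.range L, (-1 : ℝ) ^ j * genIndicator (ZMod p) (a + j) := by
      simp only [hE]
      rw [Finset.sum_range_add, add_sub_cancel_left, Finset.mul_sum]
      refine Finset.sum_congr rfl fun j _ ↦ ?_
      rw [pow_add, Nat.cast_add, ZMod.natCast_zmod_val, mul_assoc]
    have h2 := hwin a.val (ZMod.val_lt a)
    rw [h1, abs_mul, abs_pow, abs_neg, abs_one, one_pow, one_mul] at h2
    rw [← sq_abs]
    nlinarith [abs_nonneg (∑ j ∈ Finset.range L, (-1 : ℝ) ^ j * genIndicator (ZMod p) (a + j))]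
  refine (Finset.sum_le_sum fun a _ ↦ hterm a).trans_eq ?_
  rw [Finset.sum_const, Finset.card_univ, ZMod.card, nsmul_eq_mul, mul_comm]

lemma density_mul_card_divisors_bounds {n : ℕ} (hn : 0 < n) (hev : Even n) :
    1 ≤ (n.totient / (n : ℝ)) * n.divisors.card ∧ (n.totient / (n : ℝ)) ≤ 1 / 2 := by
  have hn' : (0 : ℝ) < n := by exact_mod_cast hn
  have h1 : (n : ℝ) ≤ n.totient * n.divisors.card := by
    exact_mod_cast n.le_totient_mul_card_divisors
  have h2 : 2 * (n.totient : ℝ) ≤ n := by exact_mod_cast Nat.two_mul_totient_le_of_even hev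
  constructor
  · rw [div_mul_eq_mul_div, le_div_iff₀ hn']
    linarith
  · rw [div_le_iff₀ hn']
    linarith

lemma not_isChain_odd_primRootsList {p : ℕ} (hp : p.Prime) (h7 : 7 ≤ p)
    (hlarge : 225 ^ 2 * (p - 1).divisors.card ^ 8 < p - 1) :
    ¬ (primRootsList p).IsChain fun a b ↦ (a + b) % 2 = 1 := by
  intro hchain
  have : Fact p.Prime := ⟨hp⟩
  have hodd : Odd p := hp.odd_of_ne_two (by omega)
  have hn0 : 0 < p - 1 := by omega
  obtain ⟨hθK, hθ2⟩ := density_mul_card_divisors_bounds hn0 (Nat.Odd.sub_odd hodd odd_one)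
  have hpR : ((p - 1 : ℕ) : ℝ) = p - 1 := by rw [Nat.cast_sub (by omega), Nat.cast_one]
  have h7R : (7 : ℝ) ≤ p := by exact_mod_cast h7
  have hlargeR : 225 ^ 2 * ((p - 1).divisors.card : ℝ) ^ 8 < p := by
    have : 225 ^ 2 * (p - 1).divisors.card ^ 8 < p := by omega
    exact_mod_cast this
  have hK1 : 1 ≤ (p - 1).divisors.card := Finset.card_pos.2 (Nat.nonempty_divisors.2 hn0.ne')
  have hLp : 15 * (p - 1).divisors.card ≤ p := by
    have : (p - 1).divisors.card ≤ (p - 1).divisors.card ^ 8 := Nat.le_self_pow (by norm_num) _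
    omega
  have hinj : Set.InjOn (fun j : ℕ ↦ (j : ZMod p)) (Set.Iio (15 * (p - 1).divisors.card)) := by
    intro a ha b hb hab
    have := congrArg ZMod.val hab
    simp only [Set.mem_Iio] at ha hb
    rwa [ZMod.val_natCast_of_lt (by omega), ZMod.val_natCast_of_lt (by omega)] at this
  have hlow := le_sum_sq_alternating_window (F := ZMod p) (by rw [ZMod.card]; omega) _ _ hinj
    _ _ rfl rfl
  have hup := sum_sq_alternating_window_le hodd hchain hLp
  have h := hlow.trans hup
  rw [ZMod.card] at h
  have htot : ((p - 1).totient : ℝ) = (p - 1).totient / ((p - 1 : ℕ) : ℝ) * (p - 1) := by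
    rw [← hpR, div_mul_cancel₀]
    exact_mod_cast hn0.ne'
  set θ : ℝ := (p - 1).totient / ((p - 1 : ℕ) : ℝ) with hθ
  rw [htot] at h
  push_cast at h
  set K : ℝ := ((p - 1).divisors.card : ℝ) with hK
  have hsqrt : 225 * K ^ 4 ≤ √(p : ℝ) := by
    apply Real.le_sqrt_of_sq_le
    calc (225 * K ^ 4) ^ 2 = 225 ^ 2 * K ^ 8 := by ring
      _ ≤ (p : ℝ) := hlargeR.le
  have hss : √(p : ℝ) * √(p : ℝ) = p := Real.mul_self_sqrt (by positivity)
  have herr : (15 * K) ^ 2 * (K ^ 2 * √(p : ℝ)) ≤ p := by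
    calc (15 * K) ^ 2 * (K ^ 2 * √(p : ℝ)) = 225 * K ^ 4 * √(p : ℝ) := by ring
      _ ≤ √(p : ℝ) * √(p : ℝ) := mul_le_mul_of_nonneg_right hsqrt (Real.sqrt_nonneg _)
      _ = p := hss
  have hmain : 15 * (p / 2 - 1) ≤ 15 * K * (θ * (p - 1) - θ ^ 2 * p) := by
    have h1 : (p : ℝ) / 2 - 1 ≤ (1 - θ) * p - 1 := by nlinarith
    have h2 : 1 * ((p : ℝ) / 2 - 1) ≤ (θ * K) * ((1 - θ) * p - 1) :=
      mul_le_mul hθK h1 (by linarith) (by linarith)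
    linarith
  linarith

lemma not_isChain_even_primRootsList {p : ℕ} (hp : p.Prime) (h7 : 7 ≤ p)
    (hlarge : 225 ^ 2 * (p - 1).divisors.card ^ 8 < p - 1) :
    ¬ (primRootsList p).IsChain fun a b ↦ (a + b) % 2 = 0 := by
  intro hchain
  have : Fact p.Prime := ⟨hp⟩
  have : Fact (1 < p) := ⟨hp.one_lt⟩
  have hodd : Odd p := hp.odd_of_ne_two (by omega)
  have hn0 : 0 < p - 1 := by omega
  have hpair : (primRootsList p).Pairwise fun a b ↦ (a + b) % 2 = 0 :=
    have : Trans (fun a b : ℕ ↦ (a + b) % 2 = 0) (fun a b ↦ (a + b) % 2 = 0)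
      (fun a b ↦ (a + b) % 2 = 0) := ⟨fun h1 h2 ↦ by omega⟩
    hchain.pairwise
  have hpar : ∀ a ∈ primRootsList p, a + 1 ∉ primRootsList p := by
    intro a ha hb
    have : Std.Symm fun a b : ℕ ↦ (a + b) % 2 = 0 := ⟨fun _ _ h ↦ by omega⟩
    have := hpair.forall ha hb (by omega)
    omega
  have hzero : ∑ a : ZMod p, genIndicator (ZMod p) (a + 0) * genIndicator (ZMod p) (a + 1) = 0 := by
    refine Finset.sum_eq_zero fun a _ ↦ ?_
    rw [add_zero, ← ZMod.natCast_zmod_val a]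
    have ha := ZMod.val_lt a
    rcases Nat.lt_or_ge (a.val + 1) p with h | h
    · have h2 := genIndicator_natCast h
      rw [Nat.cast_add, Nat.cast_one] at h2
      rw [genIndicator_natCast ha, h2]
      by_cases hm : a.val ∈ primRootsList p
      · simp [hpar _ hm]
      · simp [hm]
    · have : ((a.val : ZMod p) + 1) = (0 : ℕ) := by
        have h1 : a.val + 1 = p := by omega
        rw [← Nat.cast_one, ← Nat.cast_add, h1]
        simp
      rw [this, genIndicator_natCast (by omega : 0 < p)]
      simp [mem_primRootsList]
  obtain ⟨hθK, -⟩ := density_mul_card_divisors_bounds hn0 (Nat.Odd.sub_odd hodd odd_one)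
  have h := abs_genIndicator_correlation_sub_le (F := ZMod p) (by rw [ZMod.card]; omega)
    (zero_ne_one (α := ZMod p))
  rw [hzero, ZMod.card, zero_sub, abs_neg] at h
  have hlargeR : 225 ^ 2 * ((p - 1).divisors.card : ℝ) ^ 8 < p := by
    have : 225 ^ 2 * (p - 1).divisors.card ^ 8 < p := by omega
    exact_mod_cast this
  have hK1 : 1 ≤ (p - 1).divisors.card := Finset.card_pos.2 (Nat.nonempty_divisors.2 hn0.ne')
  set θ : ℝ := (p - 1).totient / ((p - 1 : ℕ) : ℝ) with hθ
  have hK1R : (1 : ℝ) ≤ (p - 1).divisors.card := by exact_mod_cast hK1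
  set K : ℝ := ((p - 1).divisors.card : ℝ) with hK
  have hp0 : (0 : ℝ) < p := by exact_mod_cast hp.pos
  have hs0 : 0 < √(p : ℝ) := Real.sqrt_pos.2 hp0
  have hss : √(p : ℝ) * √(p : ℝ) = p := Real.mul_self_sqrt hp0.le
  have h1 : θ ^ 2 * p ≤ K ^ 2 * √(p : ℝ) := (le_abs_self _).trans h
  have h2 : (p : ℝ) ≤ K ^ 4 * √(p : ℝ) := by
    calc (p : ℝ) ≤ (θ * K) ^ 2 * p := le_mul_of_one_le_left hp0.le (one_le_pow₀ hθK)
      _ = K ^ 2 * (θ ^ 2 * p) := by ring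
      _ ≤ K ^ 2 * (K ^ 2 * √(p : ℝ)) := mul_le_mul_of_nonneg_left h1 (by positivity)
      _ = K ^ 4 * √(p : ℝ) := by ring
  have h3 : √(p : ℝ) ≤ K ^ 4 := by
    refine le_of_mul_le_mul_right ?_ hs0
    rw [hss]
    exact h2
  have h4 : (p : ℝ) ≤ K ^ 8 := by
    rw [← hss]
    calc √(p : ℝ) * √(p : ℝ) ≤ K ^ 4 * K ^ 4 := mul_le_mul h3 h3 hs0.le (by positivity)
      _ = K ^ 8 := by ring
  have h5 : 0 < K ^ 8 := by positivity
  linarith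

/-- For all sufficiently large primes `p`: if `2^T - 1` is a Mersenne prime,
`T = φ(p-1) - 1`, then the `2`-adic complexity is maximal:
`C(s_n) = ⌊log₂(2^T - 1)⌋`. -/
theorem two_adic_complexity_maximal :
    ∃ P : ℕ, ∀ p : ℕ, Nat.Prime p → P ≤ p →
      (2 ^ (Nat.totient (p - 1) - 1) - 1).Prime →
      twoAdicComp p = Nat.log 2 (2 ^ (Nat.totient (p - 1) - 1) - 1) := by
  obtain ⟨P, hP⟩ := exists_forall_mul_card_divisors_pow_eight_lt (225 ^ 2)
  refine ⟨P + 7, fun p hp hPp hq ↦ ?_⟩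
  have hlarge := hP (p - 1) (by omega)
  have hgcd : Nat.gcd (2 ^ (Nat.totient (p - 1) - 1) - 1) (Stwo p) = 1 := by
    refine gcd_sum_mul_two_pow_eq_one (fun n ↦ Nat.le_of_lt_succ (Nat.mod_lt _ two_pos)) hq
      (fun h ↦ ?_) (fun h ↦ ?_)
    · exact not_isChain_even_primRootsList hp (by omega) hlarge
        (isChain_primRootsList_of_seqS_eq hp h)
    · exact not_isChain_odd_primRootsList hp (by omega) hlarge
        (isChain_primRootsList_of_seqS_eq hp h)
  rw [twoAdicComp, hgcd, Nat.div_one]
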